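/- Let G be a connected simple graph containing two spanning trees T_1 and T_2 with disjoint edge sets. Then nrc(G) ≤ 6; that is, there exists an edge coloring of G with at most 6 colors such that every pair of distinct vertices of G is joined by a nonrepetitive path. -/

import Mathlib

open SimpleGraph

/-- A list is *nonrepetitive* if it contains no block of the form `y ++ y`
with `y` nonempty. -/
def NonrepetitiveSeq {α : Type*} (l : List α) : Prop :=
  ¬ ∃ a y b : List α, y ≠ [] ∧ l = a ++ y ++ y ++ b

/-- An edge coloring of `G` is nonrepetitively connected if every pair of distinct
vertices is joined by a path whose sequence of edge colors is nonrepetitive. -/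
def IsNonrepetitivelyConnected {V : Type*} (G : SimpleGraph V) {β : Type*}
    (c : Sym2 V → β) : Prop :=
  ∀ u v : V, u ≠ v → ∃ p : G.Walk u v, p.IsPath ∧ NonrepetitiveSeq (p.edges.map c)

section NonrepetitiveSeq

variable {α : Type*}

theorem NonrepetitiveSeq.of_infix {l l' : List α} (h : NonrepetitiveSeq l) (hl : l' <:+: l) :
    NonrepetitiveSeq l' := by
  rintro ⟨a, y, b, hy, rfl⟩
  obtain ⟨s, t, rfl⟩ := hl
  exact h ⟨s ++ a, y, b ++ t, hy, by simp⟩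

theorem NonrepetitiveSeq.reverse {l : List α} (h : NonrepetitiveSeq l) :
    NonrepetitiveSeq l.reverse := by
  rintro ⟨a, y, b, hy, hl⟩
  refine h ⟨b.reverse, y.reverse, a.reverse, by simpa using hy, ?_⟩
  simpa using congrArg List.reverse hl

theorem NonrepetitiveSeq.append_of_disjoint {s t : List α} (hs : NonrepetitiveSeq s)
    (ht : NonrepetitiveSeq t) (hst : s.Disjoint t) : NonrepetitiveSeq (s ++ t) := by
  rintro ⟨a, y, b, hy, h⟩
  rw [List.append_assoc (a ++ y)] at h
  rcases List.append_eq_append_iff.1 h with ⟨c, h₁, h₂⟩ | ⟨c, h₁, h₂⟩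
  · rcases List.append_eq_append_iff.1 h₁ with ⟨d, h₃, h₄⟩ | ⟨d, h₃, h₄⟩
    · obtain rfl : d = [] := by
        refine List.eq_nil_iff_forall_not_mem.2 fun x hx => hst (a := x) ?_ ?_
        · simp [h₃, hx]
        · simp [h₂, h₄, hx]
      exact ht ⟨[], y, b, hy, by simp_all⟩
    · exact ht ⟨d, y, b, hy, by simp_all⟩
  · rcases List.append_eq_append_iff.1 h₂ with ⟨d, h₃, h₄⟩ | ⟨d, h₃, h₄⟩
    · exact hs ⟨a, y, d, hy, by simp_all⟩
    · obtain rfl : d = [] := by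
        refine List.eq_nil_iff_forall_not_mem.2 fun x hx => hst (a := x) ?_ ?_
        · simp [h₁, h₃, hx]
        · simp [h₄, hx]
      exact hs ⟨a, y, [], hy, by simp_all⟩

/-- An infinite word is square-free if no nonempty block is immediately repeated. -/
def SquareFreeWord (f : ℕ → α) : Prop :=
  ∀ i n, 0 < n → ¬ ∀ k < n, f (i + k) = f (i + n + k)

theorem SquareFreeWord.comp {β : Type*} {f : ℕ → α} (hf : SquareFreeWord f) {g : α → β}
    (hg : Function.Injective g) : SquareFreeWord (g ∘ f) :=
  fun i n hn h => hf i n hn fun k hk => hg (h k hk)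

theorem SquareFreeWord.nonrepetitiveSeq {f : ℕ → α} (hf : SquareFreeWord f) (d : ℕ) :
    NonrepetitiveSeq ((List.range d).map f) := by
  rintro ⟨a, y, b, hy, h⟩
  refine hf a.length y.length (List.length_pos_of_ne_nil hy) fun k hk => ?_
  have hd : d = a.length + y.length + y.length + b.length := by
    simpa [add_assoc] using congrArg List.length h
  have h₁ := congrArg (fun l => l[a.length + k]?) h
  have h₂ := congrArg (fun l => l[a.length + y.length + k]?) h
  simp only [List.getElem?_map] at h₁ h₂
  rw [List.getElem?_range (by omega)] at h₁ h₂
  grind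

end NonrepetitiveSeq

/-- The Thue–Morse word. -/
def thueMorse (n : ℕ) : Bool := (Nat.digits 2 n).sum.bodd

theorem thueMorse_two_mul (n : ℕ) : thueMorse (2 * n) = thueMorse n := by
  rcases Nat.eq_zero_or_pos n with rfl | hn
  · simp
  · simp [thueMorse, Nat.digits_def' (b := 2) (n := 2 * n) (by omega) (by omega)]

theorem thueMorse_two_mul_add_one (n : ℕ) : thueMorse (2 * n + 1) = !thueMorse n := by
  have h : (2 * n + 1) / 2 = n := by omega
  simp [thueMorse, h, Nat.add_mod]

theorem thueMorse_not_cube (l : ℕ) :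
    ¬ (thueMorse l = thueMorse (l + 1) ∧ thueMorse (l + 1) = thueMorse (l + 2)) := by
  rintro ⟨h₁, h₂⟩
  obtain ⟨j, rfl | rfl⟩ := Nat.even_or_odd' l
  · simp [thueMorse_two_mul, thueMorse_two_mul_add_one] at h₁
  · rw [show 2 * j + 1 + 1 = 2 * (j + 1) by ring,
      show 2 * j + 1 + 2 = 2 * (j + 1) + 1 by ring] at h₂
    simp [thueMorse_two_mul, thueMorse_two_mul_add_one] at h₂

theorem thueMorse_overlap_free (n : ℕ) (hn : 0 < n) (i : ℕ) :
    ¬ ∀ k ≤ n, thueMorse (i + k) = thueMorse (i + n + k) := by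
  induction n using Nat.strong_induction_on generalizing i with
  | _ n ih =>
  intro h
  have he := thueMorse_two_mul
  have ho := thueMorse_two_mul_add_one
  obtain ⟨m, rfl | rfl⟩ := Nat.even_or_odd' n
  · obtain ⟨j, rfl | rfl⟩ := Nat.even_or_odd' i
    · refine ih m (by omega) (by omega) j fun k hk => ?_
      have := h (2 * k) (by omega)
      rwa [show 2 * j + 2 * k = 2 * (j + k) by ring,
        show 2 * j + 2 * m + 2 * k = 2 * (j + m + k) by ring, he, he] at this
    · refine ih m (by omega) (by omega) j fun k hk => ?_
      have := h (2 * k) (by omega)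
      rw [show 2 * j + 1 + 2 * k = 2 * (j + k) + 1 by ring,
        show 2 * j + 1 + 2 * m + 2 * k = 2 * (j + m + k) + 1 by ring, ho, ho] at this
      simpa using this
  · rcases Nat.eq_zero_or_pos m with rfl | hm
    · exact thueMorse_not_cube i ⟨h 0 (by omega), h 1 (by omega)⟩
    have h₀ := h 0 (by omega)
    have h₁ := h 1 (by omega)
    have h₂ := h 2 (by omega)
    have h₃ := h 3 (by omega)
    obtain ⟨j, rfl | rfl⟩ := Nat.even_or_odd' i
    · refine thueMorse_not_cube (j + m) ?_
      rw [show 2 * j + (2 * m + 1) + 0 = 2 * (j + m) + 1 by ring, add_zero, he, ho] at h₀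
      rw [show 2 * j + (2 * m + 1) + 1 = 2 * (j + m + 1) by ring, he, ho] at h₁
      rw [show 2 * j + (2 * m + 1) + 2 = 2 * (j + m + 1) + 1 by ring,
        show 2 * j + 2 = 2 * (j + 1) by ring, he, ho] at h₂
      rw [show 2 * j + (2 * m + 1) + 3 = 2 * (j + m + 2) by ring,
        show 2 * j + 3 = 2 * (j + 1) + 1 by ring, he, ho] at h₃
      grind
    · refine thueMorse_not_cube j ?_
      rw [show 2 * j + 1 + (2 * m + 1) + 0 = 2 * (j + m + 1) by ring, add_zero, he, ho] at h₀
      rw [show 2 * j + 1 + (2 * m + 1) + 1 = 2 * (j + m + 1) + 1 by ring,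
        show 2 * j + 1 + 1 = 2 * (j + 1) by ring, he, ho] at h₁
      rw [show 2 * j + 1 + (2 * m + 1) + 2 = 2 * (j + m + 2) by ring,
        show 2 * j + 1 + 2 = 2 * (j + 1) + 1 by ring, he, ho] at h₂
      rw [show 2 * j + 1 + (2 * m + 1) + 3 = 2 * (j + m + 2) + 1 by ring,
        show 2 * j + 1 + 3 = 2 * (j + 2) by ring, he, ho] at h₃
      grind

/-- The word of differences of consecutive Thue–Morse letters. -/
def ternaryThue (n : ℕ) : Fin 3 :=
  if thueMorse n = thueMorse (n + 1) then 0 else if thueMorse n then 1 else 2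

theorem squareFreeWord_ternaryThue : SquareFreeWord ternaryThue := by
  intro i n hn h
  let t : ℕ → ℤ := fun m => (thueMorse m).toNat
  have ht : ∀ m, t m = 0 ∨ t m = 1 := fun m => by
    cases hm : thueMorse m <;> simp [t, hm]
  have hstep : ∀ k < n, t (i + k + 1) - t (i + k) = t (i + n + k + 1) - t (i + n + k) := by
    intro k hk
    have := h k hk
    revert this
    simp only [ternaryThue, t]
    cases thueMorse (i + k) <;> cases thueMorse (i + k + 1) <;>
      cases thueMorse (i + n + k) <;> cases thueMorse (i + n + k + 1) <;> simp
  have hsum : ∀ k ≤ n, t (i + k) - t i = t (i + n + k) - t (i + n) := by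
    intro k
    induction k with
    | zero => simp
    | succ k ih =>
      intro hk
      have h₁ := ih (by omega)
      have h₂ := hstep k (by omega)
      simp only [← add_assoc]
      omega
  have h₀ : t i = t (i + n) := by
    have := hsum n le_rfl
    have := ht i
    have := ht (i + n)
    have := ht (i + n + n)
    omega
  refine thueMorse_overlap_free n hn i fun k hk => ?_
  have hk' : t (i + k) = t (i + n + k) := by
    have := hsum k hk
    omega
  revert hk'
  simp only [t]
  cases thueMorse (i + k) <;> cases thueMorse (i + n + k) <;> simp

namespace SimpleGraph

variable {V : Type*} {G : SimpleGraph V}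

/-- The distance from `r` to the nearer endpoint of an edge. -/
noncomputable def edgeDepth (G : SimpleGraph V) (r : V) : Sym2 V → ℕ :=
  Sym2.lift ⟨fun a b => min (G.dist a r) (G.dist b r), fun _ _ => min_comm _ _⟩

theorem Walk.map_edgeDepth_edges {u r : V} (p : G.Walk u r) (hp : p.length = G.dist u r) :
    p.edges.map (G.edgeDepth r) = (List.range p.length).reverse := by
  induction p with
  | nil => simp
  | @cons u v r h p ih =>
    have h₁ : G.dist v r ≤ p.length := dist_le p
    have h₂ : G.dist u r ≤ G.dist v r + 1 := by
      obtain ⟨q, hq⟩ := p.reachable.exists_walk_length_eq_dist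
      simpa [hq] using dist_le (Walk.cons h q)
    rw [Walk.length_cons] at hp
    have h₃ : p.length = G.dist v r := by omega
    simp only [Walk.edges_cons, List.map_cons, ih h₃, Walk.length_cons, List.range_succ,
      List.reverse_append, List.reverse_singleton, List.singleton_append, List.cons.injEq, and_true]
    simp only [edgeDepth, Sym2.lift_mk]
    omega

/-- The initial part of a path up to the first vertex in a set containing its end. -/
theorem Walk.IsPath.exists_first_mem {u r : V} {p : G.Walk u r} (hp : p.IsPath) (S : Set V)
    (hr : r ∈ S) : ∃ w ∈ S, ∃ s : G.Walk u w, s.IsPath ∧ s.support ⊆ p.support ∧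
      s.edges <+: p.edges ∧ ∀ x ∈ s.support, x ∈ S → x = w := by
  induction p with
  | nil => exact ⟨_, hr, .nil, by simp⟩
  | @cons u v r h p ih =>
    rw [Walk.cons_isPath_iff] at hp
    by_cases hu : u ∈ S
    · exact ⟨u, hu, .nil, by simp⟩
    obtain ⟨w, hw, s, hs, hsub, hpre, hx⟩ := ih hp.1 hr
    refine ⟨w, hw, .cons h s, ?_, ?_, ?_, ?_⟩
    · exact (Walk.cons_isPath_iff _ _).2 ⟨hs, fun hus => hp.2 (hsub hus)⟩
    · simpa using List.subset_cons_of_subset u hsub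
    · simpa using hpre
    · intro x hxs hxS
      rcases List.mem_cons.1 (by simpa using hxs) with rfl | hxs
      · exact absurd hxS hu
      · exact hx x hxs hxS

/-- Two paths with a common end can be spliced along initial parts to a path between their
starts. -/
theorem Walk.IsPath.exists_splice {u v r : V} {p : G.Walk u r} {q : G.Walk v r}
    (hp : p.IsPath) (hq : q.IsPath) : ∃ s : G.Walk u v, s.IsPath ∧
      ∃ l₁ l₂, l₁ <+: p.edges ∧ l₂ <+: q.edges ∧ s.edges = l₁ ++ l₂.reverse := by
  classical
  obtain ⟨w, hw, s, hs, -, hpre, hx⟩ := hp.exists_first_mem {x | x ∈ q.support} q.end_mem_support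
  refine ⟨s.append (q.takeUntil w hw).reverse, ?_, s.edges, (q.takeUntil w hw).edges, hpre, ?_, ?_⟩
  · have ht := (hq.takeUntil hw).reverse
    rw [Walk.isPath_def, Walk.support_append, List.nodup_append]
    refine ⟨hs.support_nodup, ht.support_nodup.tail, ?_⟩
    rintro a ha _ hb rfl
    have haq : a ∈ q.support := by
      have := List.mem_of_mem_tail hb
      rw [Walk.support_reverse, List.mem_reverse] at this
      exact q.support_takeUntil_subset_support hw this
    obtain rfl := hx a ha haq
    have hn := ht.support_nodup
    rw [← Walk.cons_tail_support, List.nodup_cons] at hn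
    exact hn.1 hb
  · refine ⟨(q.dropUntil w hw).edges, ?_⟩
    rw [← Walk.edges_append, Walk.take_spec]
  · simp

/-- In a connected spanning subgraph colored along the depths by a word, every vertex is joined to
the root by a path whose color sequence is an initial part of the word, reversed. -/
theorem Connected.exists_path_to_root {T : SimpleGraph V} (hT : T.Connected) (hle : T ≤ G)
    (r u : V) {β : Type*} {c : Sym2 V → β} {f : ℕ → β}
    (hc : ∀ e ∈ T.edgeSet, c e = f (T.edgeDepth r e)) :
    ∃ p : G.Walk u r, p.IsPath ∧ ∃ d, p.edges.map c = ((List.range d).map f).reverse := by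
  obtain ⟨p, hp, hlen⟩ := hT.exists_path_of_dist u r
  refine ⟨p.mapLe hle, hp.mapLe hle, p.length, ?_⟩
  rw [Walk.edges_mapLe_eq_edges, ← List.map_reverse, ← p.map_edgeDepth_edges hlen, List.map_map]
  exact List.map_congr_left fun e he => hc e (p.edges_subset_edgeSet he)

end SimpleGraph

/-- If a connected graph `G` contains two edge-disjoint spanning trees,
then `nrc(G) ≤ 6`. -/
theorem nrc_le_six_of_two_edge_disjoint_spanning_trees {V : Type*}
    (G T₁ T₂ : SimpleGraph V) (hG : G.Connected)
    (hT₁ : T₁ ≤ G) (hT₂ : T₂ ≤ G)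
    (ht₁ : T₁.IsTree) (ht₂ : T₂.IsTree)
    (hdisj : Disjoint T₁.edgeSet T₂.edgeSet) :
    ∃ c : Sym2 V → Fin 6, IsNonrepetitivelyConnected G c := by
  classical
  obtain ⟨r⟩ := hG.nonempty
  let f₁ : ℕ → Fin 6 := Fin.castAdd 3 ∘ ternaryThue
  let f₂ : ℕ → Fin 6 := Fin.natAdd 3 ∘ ternaryThue
  have hf₁ : SquareFreeWord f₁ := squareFreeWord_ternaryThue.comp (Fin.castAdd_injective 3 3)
  have hf₂ : SquareFreeWord f₂ := squareFreeWord_ternaryThue.comp (Fin.natAdd_injective 3 3)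
  have hne : ∀ m n, f₁ m ≠ f₂ n := fun m n h => by
    have := congrArg Fin.val h
    simp only [f₁, f₂, Function.comp_apply, Fin.val_castAdd, Fin.val_natAdd] at this
    omega
  let c : Sym2 V → Fin 6 := fun e =>
    if e ∈ T₁.edgeSet then f₁ (T₁.edgeDepth r e) else f₂ (T₂.edgeDepth r e)
  refine ⟨c, fun u v _ => ?_⟩
  obtain ⟨p, hp, d₁, hpc⟩ := ht₁.1.exists_path_to_root hT₁ r u (c := c) (f := f₁)
    fun e he => if_pos he
  obtain ⟨q, hq, d₂, hqc⟩ := ht₂.1.exists_path_to_root hT₂ r v (c := c) (f := f₂)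
    fun e he => if_neg (hdisj.notMem_of_mem_right he)
  obtain ⟨s, hs, l₁, l₂, h₁, h₂, hsl⟩ := hp.exists_splice hq
  refine ⟨s, hs, ?_⟩
  have h₁' := h₁.map c
  have h₂' := h₂.map c
  rw [hpc] at h₁'
  rw [hqc] at h₂'
  rw [hsl, List.map_append, List.map_reverse]
  refine ((hf₁.nonrepetitiveSeq d₁).reverse.of_infix h₁'.isInfix).append_of_disjoint
    ((hf₂.nonrepetitiveSeq d₂).reverse.of_infix h₂'.isInfix).reverse ?_
  intro x hx₁ hx₂
  have hx₁' := h₁'.subset hx₁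
  have hx₂' := h₂'.subset (List.mem_reverse.1 hx₂)
  simp only [List.mem_reverse, List.mem_map] at hx₁' hx₂'
  obtain ⟨m, -, rfl⟩ := hx₁'
  obtain ⟨n, -, hn⟩ := hx₂'
  exact hne m n hn.symm
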